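/- Let s₂(n) denote the sum of the binary digits of the natural number n, let j := exp(2πi/3) ∈ ℂ, and define u : ℕ → ℂ by u(n) := (-1)^{s₂(n)} · j^n. Then for all natural numbers m and N, ∑_{k < 4^m · N} u(k) = 3^m · ∑_{k < N} u(k). -/

import Mathlib

/-- Sum of the binary digits of `n`. -/
def s2 (n : ℕ) : ℕ := (Nat.digits 2 n).sum

/-- The primitive cube root of unity `j = exp(2πi/3)`. -/
noncomputable def jc : ℂ := Complex.exp (2 * Real.pi * Complex.I / 3)

/-- The sequence `u n = (-1)^{s₂(n)} j^n`. -/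
noncomputable def u (n : ℕ) : ℂ := (-1) ^ s2 n * jc ^ n

theorem s2_even (n : ℕ) : s2 (2 * n) = s2 n := by
  rcases Nat.eq_zero_or_pos n with rfl | h
  · simp
  · unfold s2
    rw [Nat.digits_def' (by norm_num) (by omega)]
    simp

theorem s2_odd (n : ℕ) : s2 (2 * n + 1) = s2 n + 1 := by
  unfold s2
  rw [Nat.digits_def' (by norm_num) (by omega)]
  have h1 : (2 * n + 1) % 2 = 1 := by omega
  have h2 : (2 * n + 1) / 2 = n := by omega
  rw [h1, h2, List.sum_cons, add_comm]

theorem jc_prim : IsPrimitiveRoot jc 3 := by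
  have := Complex.isPrimitiveRoot_exp 3 (by norm_num)
  simpa [jc] using this

theorem jc_cube : jc ^ 3 = 1 := jc_prim.pow_eq_one

theorem jc_quad : jc ^ 2 + jc + 1 = 0 := by
  have h := jc_prim.geom_sum_eq_zero (by norm_num)
  simp [Finset.sum_range_succ] at h
  linear_combination h

theorem u_block (n : ℕ) :
    u (4 * n) + u (4 * n + 1) + u (4 * n + 2) + u (4 * n + 3) = 3 * u n := by
  have e0 : s2 (4 * n) = s2 n := by
    rw [show 4 * n = 2 * (2 * n) by ring, s2_even, s2_even]
  have e1 : s2 (4 * n + 1) = s2 n + 1 := by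
    rw [show 4 * n + 1 = 2 * (2 * n) + 1 by ring, s2_odd, s2_even]
  have e2 : s2 (4 * n + 2) = s2 n + 1 := by
    rw [show 4 * n + 2 = 2 * (2 * n + 1) by ring, s2_even, s2_odd]
  have e3 : s2 (4 * n + 3) = s2 n + 2 := by
    rw [show 4 * n + 3 = 2 * (2 * n + 1) + 1 by ring, s2_odd, s2_odd]
  have hj : jc ^ (4 * n) = jc ^ n := by
    rw [show 4 * n = 3 * n + n by ring, pow_add, pow_mul, jc_cube, one_pow, one_mul]
  unfold u
  rw [e0, e1, e2, e3]
  simp only [pow_add, hj]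
  linear_combination ((-1) ^ s2 n * jc ^ n) * (jc_cube - jc_quad)

theorem sum_four (N : ℕ) :
    ∑ k ∈ Finset.range (4 * N), u k = 3 * ∑ k ∈ Finset.range N, u k := by
  induction N with
  | zero => simp
  | succ n ih =>
    rw [show 4 * (n + 1) = 4 * n + 3 + 1 by ring]
    rw [Finset.sum_range_succ, Finset.sum_range_succ, Finset.sum_range_succ,
      Finset.sum_range_succ, Finset.sum_range_succ, ih]
    linear_combination u_block n

theorem stmt_16 (m N : ℕ) :
    ∑ k ∈ Finset.range (4 ^ m * N), u k =
      (3 : ℂ) ^ m * ∑ k ∈ Finset.range N, u k := by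
  induction m with
  | zero => simp
  | succ m ih =>
    rw [show 4 ^ (m + 1) * N = 4 * (4 ^ m * N) by ring, sum_four, ih]
    ring
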